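/- arXiv:2211.13598 — 2 statements merged into one kernel-verified Lean document; each statement's English description precedes it below -/
import Mathlib

section
/- Let K be a number field and f ∈ K[x] a quadratic polynomial, α ∈ K. If the dynamical Galois group G_∞(f, α) (the Galois group over K of the field generated by all iterated preimages of α under f) is abelian, then f is post-critically finite, i.e., the forward orbit of the critical point of f is finite. -/
open Polynomial

namespace PCFAux

/-- polynomial clearing denominators of the iterate -/
lemma exists_poly {E : Type*} [Field E] (a c : E) (j : ℕ) :
    ∃ G : E[X], ∀ t : E, t ≠ 0 →
      G.eval t = t ^ (2 ^ j) * (fun x : E => x ^ 2 + c)^[j] (a * (t + t⁻¹)) := by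
  induction j with
  | zero =>
    refine ⟨C a * (X ^ 2 + 1), fun t ht => ?_⟩
    simp
    field_simp
  | succ j ih =>
    obtain ⟨G, hG⟩ := ih
    refine ⟨G ^ 2 + C c * X ^ (2 ^ (j + 1)), fun t ht => ?_⟩
    rw [Function.iterate_succ_apply']
    simp only [eval_add, eval_pow, hG t ht, eval_mul, eval_C, eval_X]
    ring

lemma functional {E : Type*} [Field E] [CharZero E] (a c η i : E) (hη : η ≠ 0)
    (ha : a ≠ 0) (hi : i ^ 2 = -1) (j : ℕ) (hj : 1 ≤ j) (A : Set E) (hA : A.Infinite)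
    (hA0 : ∀ t ∈ A, t ≠ 0)
    (hAe : ∀ t ∈ A, (fun x : E => x ^ 2 + c)^[j] (a * (t + t⁻¹))
      = a * (η * t ^ (2 ^ j) + (η * t ^ (2 ^ j))⁻¹)) :
    (fun x : E => x ^ 2 + c)^[j + (j + j)] 0 = (fun x : E => x ^ 2 + c)^[j + j] 0 := by
  obtain ⟨G, hG⟩ := exists_poly a c j
  have hpoly : C η * G = C a * (C (η ^ 2) * (X ^ (2 ^ j)) ^ 2 + 1) := by
    apply Polynomial.eq_of_infinite_eval_eq
    refine hA.mono fun t ht => ?_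
    have ht0 := hA0 t ht
    have htN : t ^ (2 ^ j) ≠ 0 := pow_ne_zero _ ht0
    simp only [Set.mem_ofPred_eq, eval_mul, eval_C, hG t ht0, hAe t ht, eval_add, eval_pow, eval_X,
      eval_one]
    field_simp
  have key : ∀ t : E, t ≠ 0 → (fun x : E => x ^ 2 + c)^[j] (a * (t + t⁻¹))
      = a * (η * t ^ (2 ^ j) + (η * t ^ (2 ^ j))⁻¹) := by
    intro t ht0
    have htN : t ^ (2 ^ j) ≠ 0 := pow_ne_zero _ ht0
    have := congrArg (eval t) hpoly
    simp only [eval_mul, eval_C, hG t ht0, eval_add, eval_pow, eval_X, eval_one] at this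
    generalize (fun x : E => x ^ 2 + c)^[j] (a * (t + t⁻¹)) = z at this ⊢
    field_simp
    linear_combination this
  have hη2 : η ^ 2 = 1 := by
    have h1 := key 2 two_ne_zero
    have h2 := key 2⁻¹ (inv_ne_zero two_ne_zero)
    rw [inv_inv, add_comm (2⁻¹ : E) 2, h1] at h2
    have h3 := mul_left_cancel₀ ha h2
    have hN : (2 : E) ^ (2 ^ j) ≠ 0 := pow_ne_zero _ two_ne_zero
    rw [inv_pow] at h3
    generalize hx : (2 : E) ^ (2 ^ j) = x at *
    field_simp at h3
    have h4 : (η ^ 2 - 1) * (x ^ 2 - 1) = 0 := by linear_combination h3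
    rcases mul_eq_zero.1 h4 with h | h
    · linear_combination h
    · exfalso
      have : (2 : E) ^ (2 ^ j * 2) = 1 := by rw [pow_mul, hx]; linear_combination h
      have h5 : ((2 ^ (2 ^ j * 2) : ℕ) : E) = ((1 : ℕ) : E) := by push_cast; exact this
      have h6 := Nat.cast_injective h5
      have h7 : 1 < 2 ^ (2 ^ j * 2) := Nat.one_lt_two_pow (by positivity)
      omega
  have hev : Even (2 ^ j) := by
    obtain ⟨k, rfl⟩ : ∃ k, j = k + 1 := ⟨j - 1, by omega⟩
    exact ⟨2 ^ k, by ring⟩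
  have pow1 : ∀ δ : E, δ ^ 2 = 1 → δ ^ (2 ^ j) = 1 := by
    intro δ hδ
    obtain ⟨k, hk⟩ := hev
    rw [hk, ← two_mul, pow_mul, hδ, one_pow]
  have inv1 : ∀ δ : E, δ ^ 2 = 1 → δ⁻¹ = δ := by
    intro δ hδ
    exact inv_eq_of_mul_eq_one_left (by rw [← sq, hδ])
  have ne1 : ∀ δ : E, δ ^ 2 = 1 → δ ≠ 0 := by
    rintro δ hδ rfl
    simp at hδ
  have step : ∀ δ : E, δ ^ 2 = 1 → (fun x : E => x ^ 2 + c)^[j] (a * (δ + δ)) = a * (η + η) := by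
    intro δ hδ
    have := key δ (ne1 δ hδ)
    rwa [inv1 δ hδ, pow1 δ hδ, mul_one, inv1 η hη2] at this
  have hi0 : i ≠ 0 := by
    rintro rfl
    simp at hi
  have hδ : (η * i ^ (2 ^ j)) ^ 2 = 1 := by
    rw [mul_pow, hη2, one_mul, pow_right_comm, hi, hev.neg_one_pow]
  have hz := key i hi0
  have hi' : a * (i + i⁻¹) = 0 := by
    have : i + i⁻¹ = 0 := by
      field_simp
      linear_combination hi
    rw [this, mul_zero]
  rw [hi', inv1 _ hδ] at hz
  have e2 : (fun x : E => x ^ 2 + c)^[j + j] 0 = a * (η + η) := by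
    rw [Function.iterate_add_apply, hz, step _ hδ]
  rw [Function.iterate_add_apply, e2, step _ hη2]

lemma pigeon {P : Type*} [Finite P] (σ : ℕ → P) :
    ∃ j, 1 ≤ j ∧ {m | σ (m + j) = σ m}.Infinite := by
  by_contra! hcon
  have := Fintype.ofFinite P
  have hfin : (⋃ j ∈ Set.Icc 1 (Fintype.card P), {m | σ (m + j) = σ m}).Finite := by
    refine Set.Finite.biUnion (Set.finite_Icc _ _) fun j hj => ?_
    exact hcon j hj.1
  obtain ⟨M, hM⟩ := hfin.bddAbove
  obtain ⟨x, y, hxy, he⟩ := Fintype.exists_ne_map_eq_of_card_lt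
    (fun i : Fin (Fintype.card P + 1) => σ (M + 1 + i)) (by simp)
  wlog h : x < y generalizing x y
  · exact this y x hxy.symm he.symm (lt_of_le_of_ne (not_lt.1 h) hxy.symm)
  have h' : (x : ℕ) < y := h
  have hy := y.2
  have : M + 1 + (x : ℕ) ≤ M := hM (by
    simp only [Set.mem_iUnion]
    refine ⟨y - x, ⟨by omega, by omega⟩, ?_⟩
    simp only [Set.mem_ofPred_eq]
    rw [show M + 1 + (x : ℕ) + (y - x) = M + 1 + y by omega]
    exact he.symm)
  omega

lemma infinite_fiber {X : Type*} (A : Set ℕ) (hA : A.Infinite) (ρ : ℕ → X) (T : Set X)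
    (hT : T.Finite) (h : ∀ m ∈ A, ρ m ∈ T) : ∃ η ∈ T, {m | m ∈ A ∧ ρ m = η}.Infinite := by
  by_contra! hcon
  refine hA (Set.Finite.subset (hT.biUnion fun η hη => hcon η hη) ?_)
  intro m hm
  simp only [Set.mem_iUnion]
  exact ⟨ρ m, h m hm, hm, rfl⟩

lemma seq_growth (r : ℕ → ℝ) (C : ℝ) (h : ∀ n, |(|r (n + 1)| - 2 * |r n|)| ≤ C) (n j : ℕ) :
    |(|r (n + j)| - 2 ^ j * |r n|)| ≤ 2 ^ j * C := by
  have hC : 0 ≤ C := le_trans (abs_nonneg _) (h 0)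
  suffices |(|r (n + j)| - 2 ^ j * |r n|)| ≤ (2 ^ j - 1) * C by linarith
  induction j with
  | zero => simp
  | succ j ih =>
    have h1 := h (n + j)
    rw [abs_le] at *
    rw [← add_assoc, pow_succ]
    constructor <;> nlinarith [ih.1, ih.2, h1.1, h1.2]

lemma seq_growth_signed (r : ℕ → ℝ) (C : ℝ) (h : ∀ n, |(|r (n + 1)| - 2 * |r n|)| ≤ C) (n j : ℕ)
    (hs : 0 ≤ r (n + j) ↔ 0 ≤ r n) :
    |r (n + j) - 2 ^ j * r n| ≤ 2 ^ j * C := by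
  have := seq_growth r C h n j
  by_cases h0 : 0 ≤ r n
  · rwa [abs_of_nonneg h0, abs_of_nonneg (hs.2 h0)] at this
  · have h1 : ¬ 0 ≤ r (n + j) := fun h => h0 (hs.1 h)
    rw [abs_of_neg (not_le.1 h0), abs_of_neg (not_le.1 h1)] at this
    rw [← abs_neg]
    convert this using 2
    ring

lemma log_max_t {L : Type*} [Field L] (v : AbsoluteValue L ℝ) (t : L) (ht : t ≠ 0) :
    |Real.log (max 1 (v (t + t⁻¹))) - (|Real.log (v t)|)| ≤ Real.log 2 := by
  have hv : 0 < v t := v.pos ht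
  have hinv : v t⁻¹ = (v t)⁻¹ := map_inv₀ v t
  have main : ∀ s : L, s ≠ 0 → 1 ≤ v s →
      |Real.log (max 1 (v (s + s⁻¹))) - Real.log (v s)| ≤ Real.log 2 := by
    intro s hs h1
    have hsinv : v s⁻¹ = (v s)⁻¹ := map_inv₀ v s
    have hs0 : 0 < v s := v.pos hs
    have hi1 : (v s)⁻¹ ≤ 1 := inv_le_one_of_one_le₀ h1
    have hup : max 1 (v (s + s⁻¹)) ≤ 2 * v s := by
      apply max_le (by linarith)
      calc v (s + s⁻¹) ≤ v s + v s⁻¹ := v.add_le _ _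
        _ ≤ 2 * v s := by rw [hsinv]; linarith
    have hlo : v s ≤ 2 * max 1 (v (s + s⁻¹)) := by
      have h2 : v s ≤ v (s + s⁻¹) + v s⁻¹ := by
        have := v.add_le (s + s⁻¹) (-s⁻¹)
        rwa [add_neg_cancel_right, v.map_neg] at this
      rw [hsinv] at h2
      have := le_max_left 1 (v (s + s⁻¹))
      have := le_max_right 1 (v (s + s⁻¹))
      linarith
    have hm : 0 < max 1 (v (s + s⁻¹)) := lt_of_lt_of_le one_pos (le_max_left _ _)
    have e1 := Real.log_le_log hm hup
    have e2 := Real.log_le_log hs0 hlo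
    rw [Real.log_mul two_ne_zero hs0.ne'] at e1
    rw [Real.log_mul two_ne_zero hm.ne'] at e2
    rw [abs_le]
    constructor <;> linarith
  rcases le_total 1 (v t) with h | h
  · rw [abs_of_nonneg (Real.log_nonneg h)]
    exact main t ht h
  · rw [abs_of_nonpos (Real.log_nonpos hv.le h), ← Real.log_inv, ← hinv]
    have := main t⁻¹ (inv_ne_zero ht) (by rw [hinv]; exact (one_le_inv₀ hv).2 h)
    rwa [inv_inv, add_comm] at this

lemma log_max_quad {L : Type*} [Field L] (v : AbsoluteValue L ℝ) (a b : L) (ha : a ≠ 0) :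
    ∃ C : ℝ, ∀ x : L,
      |Real.log (max 1 (v (a * x ^ 2 + b))) - 2 * Real.log (max 1 (v x))| ≤ C := by
  have hva : 0 < v a := v.pos ha
  have hvb : 0 ≤ v b := v.nonneg b
  set D : ℝ := max 1 (max (v a + v b) ((1 + v b) / v a)) with hD
  have hD1 : 1 ≤ D := le_max_left _ _
  have hD2 : v a + v b ≤ D := (le_max_left _ _).trans (le_max_right _ _)
  have hD3 : (1 + v b) / v a ≤ D := (le_max_right _ _).trans (le_max_right _ _)
  refine ⟨Real.log D, fun x => ?_⟩
  have hx := le_max_left 1 (v x)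
  have hx' := le_max_right 1 (v x)
  have hy := le_max_left 1 (v (a * x ^ 2 + b))
  have hy' := le_max_right 1 (v (a * x ^ 2 + b))
  have hvx := v.nonneg x
  generalize hM : max 1 (v x) = M at *
  generalize hM' : max 1 (v (a * x ^ 2 + b)) = M' at *
  have hM2 : 1 ≤ M ^ 2 := one_le_pow₀ hx
  have hxM2 : v x ^ 2 ≤ M ^ 2 := pow_le_pow_left₀ hvx hx' 2
  have up : M' ≤ D * M ^ 2 := by
    rw [← hM']
    apply max_le (by nlinarith)
    calc v (a * x ^ 2 + b) ≤ v (a * x ^ 2) + v b := v.add_le _ _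
      _ = v a * v x ^ 2 + v b := by rw [map_mul, map_pow]
      _ ≤ v a * M ^ 2 + v b * M ^ 2 := by nlinarith
      _ = (v a + v b) * M ^ 2 := by ring
      _ ≤ D * M ^ 2 := by nlinarith
  have lo : M ^ 2 ≤ D * M' := by
    have h1 : v a * v x ^ 2 ≤ M' + v b := by
      have := v.add_le (a * x ^ 2 + b) (-b)
      rw [add_neg_cancel_right, v.map_neg, map_mul, map_pow] at this
      linarith
    have h2 : v x ^ 2 ≤ D * M' := by
      have : v x ^ 2 ≤ (M' + v b) / v a := by
        rw [le_div_iff₀ hva]; linarith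
      refine this.trans ?_
      have h3 : (M' + v b) / v a ≤ (1 + v b) / v a * M' := by
        rw [div_mul_eq_mul_div]
        gcongr
        nlinarith
      refine h3.trans ?_
      gcongr
    rcases le_total 1 (v x) with h | h
    · rw [← hM, max_eq_right h]; exact h2
    · rw [← hM, max_eq_left h]; nlinarith
  have hM0 : 0 < M := by linarith
  have hM'0 : 0 < M' := by linarith
  have hD0 : 0 < D := by linarith
  have e1 := Real.log_le_log hM'0 up
  have e2 := Real.log_le_log (by positivity) lo
  rw [Real.log_mul hD0.ne' (by positivity), Real.log_pow] at e1
  rw [Real.log_mul hD0.ne' hM'0.ne', Real.log_pow] at e2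
  push_cast at e1 e2
  rw [abs_le]
  constructor <;> linarith

lemma local_growth {L : Type*} [Field L] (v : AbsoluteValue L ℝ) (a c : L) (ha : a ≠ 0)
    (t : ℕ → L) (ht : ∀ n, t n ≠ 0)
    (hrec : ∀ n, a * (t (n + 1) + (t (n + 1))⁻¹) = (a * (t n + (t n)⁻¹)) ^ 2 + c) :
    ∃ C : ℝ, ∀ n, |(|Real.log (v (t (n + 1)))| - 2 * |Real.log (v (t n))|)| ≤ C := by
  obtain ⟨C, hC⟩ := log_max_quad v a (c / a) ha
  refine ⟨C + 3 * Real.log 2, fun n => ?_⟩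
  have h1 := log_max_t v (t n) (ht n)
  have h2 := log_max_t v (t (n + 1)) (ht (n + 1))
  have h3 := hC (t n + (t n)⁻¹)
  have h4 : a * (t n + (t n)⁻¹) ^ 2 + c / a = t (n + 1) + (t (n + 1))⁻¹ := by
    apply mul_left_cancel₀ ha
    rw [hrec n, mul_add, mul_div_cancel₀ _ ha]
    ring
  rw [h4] at h3
  rw [abs_le] at *
  constructor <;> linarith [h1.1, h1.2, h2.1, h2.2, h3.1, h3.2]

lemma unit_of_trace {L : Type*} [Field L] (v : AbsoluteValue L ℝ) (hv : IsNonarchimedean v)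
    (t : L) (ht : t ≠ 0) (h : v (t + t⁻¹) ≤ 1) : v t = 1 := by
  have main : ∀ s : L, s ≠ 0 → v (s + s⁻¹) ≤ 1 → v s ≤ 1 := by
    intro s hs h
    by_contra! h1
    have hi : v s⁻¹ ≤ 1 := by rw [map_inv₀]; exact inv_le_one_of_one_le₀ h1.le
    have := hv (s + s⁻¹) (-s⁻¹)
    rw [add_neg_cancel_right, v.map_neg] at this
    exact absurd (this.trans (max_le h hi)) (not_le.2 h1)
  apply le_antisymm (main t ht h)
  have := main t⁻¹ (inv_ne_zero ht) (by rwa [inv_inv, add_comm])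
  rw [map_inv₀] at this
  exact (inv_le_one₀ (v.pos ht)).1 this

open Height AdmissibleAbsValues in
lemma height_bound {L : Type*} [Field L] [AdmissibleAbsValues L]
    (S : Set (nonarchAbsVal (K := L))) (hS : S.Finite) (B : AbsoluteValue L ℝ → ℝ) (x : L)
    (hout : ∀ v : nonarchAbsVal (K := L), v ∉ S → v.val x = 1)
    (hin : ∀ v ∈ S, Real.posLog (v.val x) ≤ B v.val)
    (harch : ∀ v ∈ archAbsVal (K := L), Real.posLog (v x) ≤ B v) :
    logHeight₁ x ≤ (archAbsVal.map B).sum + ∑ v ∈ hS.toFinset, B v.val := by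
  rw [logHeight₁_eq]
  apply add_le_add
  · exact Multiset.sum_map_le_sum_map _ _ harch
  · rw [finsum_eq_sum_of_support_subset (s := hS.toFinset)]
    · exact Finset.sum_le_sum fun v hv => hin v (by simpa using hv)
    · intro v hv
      by_contra h
      apply hv
      simp [hout v (by simpa using h)]

lemma iterate_finite {X : Type*} (F : X → X) (x : X) (m n : ℕ) (hmn : m < n)
    (h : F^[n] x = F^[m] x) : (Set.range fun k => F^[k] x).Finite := by
  refine (((Finset.range n).finite_toSet).image (fun k => F^[k] x)).subset ?_
  rintro _ ⟨k, rfl⟩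
  induction k using Nat.strong_induction_on with
  | _ k ih =>
    by_cases hk : k < n
    · exact ⟨k, by simpa using hk, rfl⟩
    · have : F^[k] x = F^[k - n + m] x := by
        conv_lhs => rw [show k = k - n + n by omega, Function.iterate_add_apply, h,
          ← Function.iterate_add_apply]
      simp only [this]
      exact ih _ (by omega)

open Height AdmissibleAbsValues in
theorem arith (L : Type*) [Field L] [NumberField L] (c w : L) (hw : w ≠ 0)
    (h : ∀ n, 2 ≤ n → ∃ y : L, y ^ 2 = ((fun x : L => x ^ 2 + c)^[n] 0) ^ 2 - w ^ 2) :
    (Set.range fun n : ℕ => (fun x : L => x ^ 2 + c)^[n] 0).Finite := by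
  by_cases hc : c = 0
  · refine iterate_finite _ 0 0 1 one_pos ?_
    simp [hc]
  by_contra hinf
  set F : L → L := fun x : L => x ^ 2 + c with hF
  have hinj : ∀ m n, F^[n] 0 = F^[m] 0 → n = m := by
    intro m n hmn
    by_contra hne
    rcases lt_or_gt_of_ne hne with h1 | h1
    · exact hinf (iterate_finite F 0 n m h1 hmn.symm)
    · exact hinf (iterate_finite F 0 m n h1 hmn)
  choose y hy using fun n => h (n + 2) (by omega)
  set a : L := w / 2 with ha_def
  have ha : a ≠ 0 := div_ne_zero hw two_ne_zero
  set t : ℕ → L := fun n => (F^[n + 2] 0 + y n) / w with ht_def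
  have hprod : ∀ n, (F^[n + 2] 0 + y n) * (F^[n + 2] 0 - y n) = w ^ 2 := by
    intro n; linear_combination -hy n
  have ht : ∀ n, t n ≠ 0 := by
    intro n h0
    have h1 : F^[n + 2] 0 + y n = 0 := by
      rcases div_eq_zero_iff.1 h0 with h | h
      · exact h
      · exact absurd h hw
    have := hprod n
    rw [h1, zero_mul] at this
    exact pow_ne_zero 2 hw this.symm
  have htinv : ∀ n, (t n)⁻¹ = (F^[n + 2] 0 - y n) / w := by
    intro n
    apply inv_eq_of_mul_eq_one_left
    simp only [ht_def]
    have := hprod n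
    field_simp
    linear_combination this
  have htr : ∀ n, F^[n + 2] 0 = a * (t n + (t n)⁻¹) := by
    intro n
    rw [htinv]
    simp only [ht_def, ha_def]
    field_simp
    ring
  have hrec : ∀ n, a * (t (n + 1) + (t (n + 1))⁻¹) = (a * (t n + (t n)⁻¹)) ^ 2 + c := by
    intro n
    rw [← htr, ← htr, show n + 1 + 2 = (n + 2) + 1 by ring, Function.iterate_succ_apply']
  choose Cv hCv using fun v : AbsoluteValue L ℝ => local_growth v a c ha t ht hrec
  set S : Set (nonarchAbsVal (K := L)) :=
    {v | v.val a ≠ 1} ∪ {v | v.val c ≠ 1} with hS_def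
  have hS : S.Finite :=
    Set.Finite.union (hasFiniteMulSupport ha) (hasFiniteMulSupport hc)
  have hgood : ∀ v : nonarchAbsVal (K := L), v ∉ S → ∀ n, v.val (t n) = 1 := by
    intro v hv n
    have hva : v.val a = 1 := by
      by_contra h; exact hv (Or.inl h)
    have hvc : v.val c = 1 := by
      by_contra h; exact hv (Or.inr h)
    have hna := isNonarchimedean v.val v.2
    have hbounded : ∀ k, v.val (F^[k] 0) ≤ 1 := by
      intro k
      induction k with
      | zero => simp
      | succ k ih =>
        rw [Function.iterate_succ_apply']
        refine (hna _ _).trans (max_le ?_ hvc.le)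
        rw [map_pow]
        exact pow_le_one₀ (v.val.nonneg _) ih
    apply unit_of_trace v.val hna _ (ht n)
    have := hbounded (n + 2)
    rwa [htr, map_mul, hva, one_mul] at this
  set U : Set (AbsoluteValue L ℝ) :=
    {v | v ∈ archAbsVal (K := L)} ∪ (fun v : nonarchAbsVal (K := L) => v.val) '' S with hU_def
  have hU : U.Finite := by
    refine Set.Finite.union ?_ (hS.image _)
    classical
    exact (archAbsVal (K := L)).toFinset.finite_toSet.subset (fun v hv => by simpa using hv)
  have : Finite U := hU
  obtain ⟨j, hj, hA⟩ := pigeon (P := U → Prop) (fun n v => 0 ≤ Real.log (v.val (t n)))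
  set A := {m | (fun v : U => 0 ≤ Real.log (v.val (t (m + j))))
    = (fun v : U => 0 ≤ Real.log (v.val (t m)))} with hA_def
  have hsgn : ∀ m ∈ A, ∀ v ∈ U, Real.posLog (v (t (m + j) / t m ^ (2 ^ j))) ≤ 2 ^ j * Cv v := by
    intro m hm v hv
    have h1 : (0 ≤ Real.log (v (t (m + j)))) = (0 ≤ Real.log (v (t m))) := congrFun hm ⟨v, hv⟩
    have h2 := seq_growth_signed (fun n => Real.log (v (t n))) (Cv v) (hCv v) m j (iff_of_eq h1)
    have h3 : Real.log (v (t (m + j) / t m ^ (2 ^ j)))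
        = Real.log (v (t (m + j))) - 2 ^ j * Real.log (v (t m)) := by
      rw [map_div₀, map_pow, Real.log_div (v.pos (ht _)).ne' (pow_ne_zero _ (v.pos (ht _)).ne'),
        Real.log_pow]
      push_cast
      rfl
    change max 0 (Real.log (v (t (m + j) / t m ^ (2 ^ j)))) ≤ _
    rw [h3]
    exact max_le ((abs_nonneg _).trans h2) ((le_abs_self _).trans h2)
  set B : ℝ := ((archAbsVal (K := L)).map fun v => 2 ^ j * Cv v).sum +
    ∑ v ∈ hS.toFinset, 2 ^ j * Cv v.val with hB_def
  have hbd : ∀ m ∈ A, t (m + j) / t m ^ (2 ^ j) ∈ {x : L | logHeight₁ x ≤ B} := by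
    intro m hm
    refine height_bound S hS (fun v => 2 ^ j * Cv v) _ ?_ ?_ ?_
    · intro v hv
      rw [map_div₀, map_pow, hgood v hv, hgood v hv, one_pow, div_one]
    · intro v hv
      exact hsgn m hm v.val (Or.inr ⟨v, hv, rfl⟩)
    · intro v hv
      exact hsgn m hm v (Or.inl hv)
  obtain ⟨η, -, hη⟩ := infinite_fiber A hA (fun m => t (m + j) / t m ^ (2 ^ j)) _
    (NumberField.finite_setOfPred_logHeight₁_le L B) hbd
  have hη0 : η ≠ 0 := by
    obtain ⟨m, -, hm⟩ := hη.nonempty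
    rw [← hm]
    exact div_ne_zero (ht _) (pow_ne_zero _ (ht _))
  let φ : L →+* AlgebraicClosure L := algebraMap L (AlgebraicClosure L)
  obtain ⟨i, hi⟩ := IsAlgClosed.exists_pow_nat_eq (-1 : AlgebraicClosure L) (n := 2) two_pos
  have hφ : ∀ k x, φ (F^[k] x) = (fun x : AlgebraicClosure L => x ^ 2 + φ c)^[k] (φ x) := by
    intro k x
    induction k with
    | zero => rfl
    | succ k ih => rw [Function.iterate_succ_apply', Function.iterate_succ_apply', ← ih]; simp [hF]
  have : CharZero (AlgebraicClosure L) := charZero_of_injective_algebraMap φ.injective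
  have hfun := functional (φ a) (φ c) (φ η) i (by simpa using hη0) (by simpa using ha) hi j hj
    ((fun m => φ (t m)) '' {m | m ∈ A ∧ t (m + j) / t m ^ (2 ^ j) = η})
    (hη.image (by
      intro m _ n _ hmn
      have h1 : t m = t n := φ.injective hmn
      have h2 := hinj (n + 2) (m + 2) (by rw [htr, htr, h1])
      omega))
    (by
      rintro _ ⟨m, -, rfl⟩
      simpa using ht m)
    (by
      rintro _ ⟨m, ⟨-, hm⟩, rfl⟩
      have h1 : η * t m ^ (2 ^ j) = t (m + j) := by
        rw [← hm, div_mul_cancel₀ _ (pow_ne_zero _ (ht _))]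
      have h2 : F^[j] (a * (t m + (t m)⁻¹)) = a * (t (m + j) + (t (m + j))⁻¹) := by
        rw [← htr, ← htr, ← Function.iterate_add_apply]
        congr 1
        ring_nf
      rw [← h1] at h2
      have h3 := congrArg φ h2
      rw [hφ] at h3
      simpa using h3)
  have h0 := hφ (j + (j + j)) 0
  have h0' := hφ (j + j) 0
  rw [map_zero] at h0 h0'
  rw [← h0, ← h0'] at hfun
  have := hinj _ _ (φ.injective hfun)
  omega

lemma root_comm {K E : Type*} [Field K] [Field E] [Algebra K E] [IsAlgClosed E] (c α : K)
    (hcomm : ∀ (σ τ : E ≃ₐ[K] E) (n : ℕ) (β : E),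
      (fun x : E => x ^ 2 + algebraMap K E c)^[n] β = algebraMap K E α →
        σ (τ β) = τ (σ β)) (m : ℕ) :
    ∀ (n : ℕ) (w : E), (fun x : E => x ^ 2 + algebraMap K E c)^[n] w = algebraMap K E α →
      ∃ s : E, s ^ 2 = (fun x : E => x ^ 2 + algebraMap K E c)^[m + 2] 0 - w ∧
        ∀ σ τ : E ≃ₐ[K] E, σ (τ s) = τ (σ s) := by
  have pre : ∀ (n : ℕ) (w : E),
      (fun x : E => x ^ 2 + algebraMap K E c)^[n] w = algebraMap K E α →
      ∃ u : E, u ^ 2 = w - algebraMap K E c ∧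
        (fun x : E => x ^ 2 + algebraMap K E c)^[n + 1] u = algebraMap K E α ∧
        (fun x : E => x ^ 2 + algebraMap K E c)^[n + 1] (-u) = algebraMap K E α := by
    intro n w hw
    obtain ⟨u, hu⟩ := IsAlgClosed.exists_pow_nat_eq (w - algebraMap K E c) (n := 2) two_pos
    refine ⟨u, hu, ?_, ?_⟩
    · rw [Function.iterate_succ_apply]
      simp only [hu, sub_add_cancel, hw]
    · rw [Function.iterate_succ_apply]
      simp only [neg_sq, hu, sub_add_cancel, hw]
  induction m with
  | zero =>
    intro n w hw
    obtain ⟨u, hu, h1, h2⟩ := pre n w hw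
    obtain ⟨p, hp, hp1, -⟩ := pre _ _ h1
    obtain ⟨q, hq, hq1, -⟩ := pre _ _ h2
    refine ⟨p * q, ?_, fun σ τ => ?_⟩
    · simp only [Function.iterate_succ_apply, Function.iterate_zero_apply]
      rw [mul_pow, hp, hq]
      linear_combination -hu
    · simp only [map_mul]
      rw [hcomm σ τ _ _ hp1, hcomm σ τ _ _ hq1]
  | succ m ih =>
    intro n w hw
    obtain ⟨u, hu, h1, h2⟩ := pre n w hw
    obtain ⟨p, hp, hp1⟩ := ih _ _ h1
    obtain ⟨q, hq, hq1⟩ := ih _ _ h2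
    refine ⟨p * q, ?_, fun σ τ => ?_⟩
    · rw [show m + 1 + 2 = (m + 2) + 1 by ring, Function.iterate_succ_apply', mul_pow, hp, hq]
      linear_combination -hu
    · simp only [map_mul]
      rw [hp1, hq1]

lemma exists_sqrt {K : Type*} [Field K] [NumberField K] (c α : K)
    (hcomm : ∀ (σ τ : AlgebraicClosure K ≃ₐ[K] AlgebraicClosure K) (n : ℕ) (β : AlgebraicClosure K),
      (fun x : AlgebraicClosure K => x ^ 2 + algebraMap K (AlgebraicClosure K) c)^[n] β
        = algebraMap K (AlgebraicClosure K) α → σ (τ β) = τ (σ β))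
    (b : K) (w : AlgebraicClosure K)
    (hwb : w ^ 2 + algebraMap K (AlgebraicClosure K) c = algebraMap K (AlgebraicClosure K) b)
    (n : ℕ) (hn : (fun x : AlgebraicClosure K => x ^ 2 + algebraMap K (AlgebraicClosure K) c)^[n] w
        = algebraMap K (AlgebraicClosure K) α)
    (hw : w ∉ Set.range (algebraMap K (AlgebraicClosure K))) (m : ℕ) :
    ∃ y ∈ IntermediateField.adjoin K {w}, y ^ 2 =
      ((fun x : AlgebraicClosure K => x ^ 2 + algebraMap K (AlgebraicClosure K) c)^[m + 2] 0) ^ 2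
        - w ^ 2 := by
  obtain ⟨τ, hτ⟩ : ∃ τ : AlgebraicClosure K ≃ₐ[K] AlgebraicClosure K, τ w ≠ w := by
    by_contra! hcon
    exact hw ((InfiniteGalois.mem_range_algebraMap_iff_fixed w).2 hcon)
  have hw2 : w ^ 2 = algebraMap K (AlgebraicClosure K) (b - c) := by
    rw [map_sub, ← hwb]; ring
  have hτw : τ w = -w := by
    have h1 : (τ w) ^ 2 = w ^ 2 := by rw [← map_pow, hw2, AlgEquiv.commutes]
    rcases sq_eq_sq_iff_eq_or_eq_neg.1 h1 with h | h
    · exact absurd h hτ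
    · exact h
  obtain ⟨s, hs, hsc⟩ := root_comm c α hcomm m n w hn
  have hfix : ∀ σ : AlgebraicClosure K ≃ₐ[K] AlgebraicClosure K,
      σ ((fun x : AlgebraicClosure K => x ^ 2 + algebraMap K (AlgebraicClosure K) c)^[m + 2] 0)
      = (fun x : AlgebraicClosure K => x ^ 2 + algebraMap K (AlgebraicClosure K) c)^[m + 2] 0 := by
    intro σ
    generalize m + 2 = k
    induction k with
    | zero => simp
    | succ k ih => simp only [Function.iterate_succ_apply', map_add, map_pow, ih,
        AlgEquiv.commutes]
  refine ⟨s * τ s, ?_, ?_⟩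
  · have : s * τ s ∈ Set.range (algebraMap (IntermediateField.adjoin K {w}) (AlgebraicClosure K)) := by
      refine (InfiniteGalois.mem_range_algebraMap_iff_fixed
        (k := IntermediateField.adjoin K {w}) (s * τ s)).2 fun σ => ?_
      have hσw : σ w = w := σ.commutes
        (⟨w, IntermediateField.mem_adjoin_simple_self K w⟩ : IntermediateField.adjoin K {w})
      have e : ∀ z, σ z = (σ.restrictScalars K) z := fun z => rfl
      have hσs : (σ.restrictScalars K s) ^ 2 = s ^ 2 := by
        rw [← map_pow, hs, map_sub, hfix, ← e, hσw]
      rw [e, map_mul, hsc]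
      rcases sq_eq_sq_iff_eq_or_eq_neg.1 hσs with h | h
      · rw [h]
      · rw [h, map_neg, neg_mul_neg]
    obtain ⟨z, hz⟩ := this
    rw [← hz]
    exact z.2
  · rw [mul_pow, ← map_pow, hs, map_sub, hfix, hτw]
    ring

open Height in
lemma backward_finite {K : Type*} [Field K] [NumberField K] (c α : K) :
    {x : K | ∃ n : ℕ, (fun x : K => x ^ 2 + c)^[n] x = α}.Finite := by
  set R : ℝ := max (logHeight₁ α) (logHeight₁ c + Height.totalWeight K * Real.log 2) with hR
  refine (NumberField.finite_setOfPred_logHeight₁_le K R).subset ?_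
  rintro x ⟨n, hn⟩
  simp only [Set.mem_ofPred_eq]
  induction n generalizing x with
  | zero =>
    simp only [Function.iterate_zero_apply] at hn
    rw [hn]
    exact le_max_left _ _
  | succ n ih =>
    have h1 := ih hn
    have h2 := logHeight₁_sub_le (x ^ 2 + c) c
    rw [add_sub_cancel_right, logHeight₁_pow] at h2
    push_cast at h2
    have h3 := le_max_right (logHeight₁ α) (logHeight₁ c + Height.totalWeight K * Real.log 2)
    simp only at h1
    linarith

theorem core {K : Type*} [Field K] [NumberField K] (c α : K)
    (hcomm : ∀ (σ τ : AlgebraicClosure K ≃ₐ[K] AlgebraicClosure K) (n : ℕ) (β : AlgebraicClosure K),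
      (fun x : AlgebraicClosure K => x ^ 2 + algebraMap K (AlgebraicClosure K) c)^[n] β
        = algebraMap K (AlgebraicClosure K) α → σ (τ β) = τ (σ β)) :
    (Set.range fun n : ℕ => (fun x : K => x ^ 2 + c)^[n] 0).Finite := by
  have hφ : ∀ k x, algebraMap K (AlgebraicClosure K) ((fun x : K => x ^ 2 + c)^[k] x) =
      (fun x : AlgebraicClosure K => x ^ 2 + algebraMap K (AlgebraicClosure K) c)^[k]
        (algebraMap K _ x) := by
    intro k x
    induction k with
    | zero => rfl
    | succ k ih => rw [Function.iterate_succ_apply', Function.iterate_succ_apply', ← ih]; simp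
  by_cases hall : ∀ (n : ℕ) (x : AlgebraicClosure K),
      (fun x : AlgebraicClosure K => x ^ 2 + algebraMap K (AlgebraicClosure K) c)^[n] x
        = algebraMap K (AlgebraicClosure K) α → x ∈ Set.range (algebraMap K (AlgebraicClosure K))
  · have hfin := backward_finite c α
    set A := {x : K | ∃ n : ℕ, (fun x : K => x ^ 2 + c)^[n] x = α} with hA
    have hsq : ∀ z : A, ∃ u : K, u ^ 2 + c = z.1 := by
      rintro ⟨z, n, hn⟩
      obtain ⟨u, hu⟩ := IsAlgClosed.exists_pow_nat_eq
        (algebraMap K (AlgebraicClosure K) (z - c)) (n := 2) two_pos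
      obtain ⟨u', rfl⟩ := hall (n + 1) u (by
        rw [Function.iterate_succ_apply]
        simp only [hu]
        rw [← map_add, sub_add_cancel, ← hφ, hn])
      refine ⟨u', ?_⟩
      rw [← map_pow] at hu
      have := (algebraMap K (AlgebraicClosure K)).injective hu
      rw [this]; simp
    have hmem : ∀ (z : A) (u : K), u ^ 2 + c = z.1 → u ∈ A := by
      rintro ⟨z, n, hn⟩ u hu
      refine ⟨n + 1, ?_⟩
      rw [Function.iterate_succ_apply]
      simp only [hu]
      exact hn
    choose g hg using hsq
    have : Finite A := hfin
    let G : A → A := fun z => ⟨g z, hmem z _ (hg z)⟩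
    have hGinj : Function.Injective G := by
      intro z z' h
      have : g z = g z' := congrArg Subtype.val h
      apply Subtype.ext
      rw [← hg z, ← hg z', this]
    have hGs : Function.Surjective G := Finite.surjective_of_injective hGinj
    have hz : ∀ z : A, g z = 0 := by
      intro z
      obtain ⟨z', hz'⟩ := hGs ⟨-g z, hmem z _ (by rw [neg_sq, hg])⟩
      have h1 : g z' = -g z := congrArg Subtype.val hz'
      have h2 : z' = z := by
        apply Subtype.ext
        rw [← hg z, ← hg z', h1, neg_sq]
      rw [h2] at h1
      exact self_eq_neg.1 h1
    let z0 : A := ⟨α, 0, rfl⟩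
    have h0 := hz (G z0)
    have h1 := hg (G z0)
    have h2 : (G z0).1 = 0 := hz z0
    rw [h0, h2] at h1
    have hc : c = 0 := by simpa using h1
    refine iterate_finite _ 0 0 1 one_pos ?_
    simp [hc]
  · push Not at hall
    classical
    have hn := Nat.find_spec hall
    have hmin := fun m => Nat.find_min hall (m := m)
    generalize Nat.find hall = n at hn hmin
    obtain ⟨w, hw, hwK⟩ := hn
    rcases n with _ | n
    · exact absurd ⟨α, hw.symm⟩ hwK
    have hb := hmin n (Nat.lt_succ_self n)
    push Not at hb
    obtain ⟨b, hb⟩ := hb _ hw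
    let L := IntermediateField.adjoin K {w}
    have : FiniteDimensional K L :=
      IntermediateField.adjoin.finiteDimensional (Algebra.IsIntegral.isIntegral w)
    have : CharZero L := charZero_of_injective_algebraMap (algebraMap K L).injective
    have : NumberField L := NumberField.of_module_finite K L
    let w' : L := ⟨w, IntermediateField.mem_adjoin_simple_self K w⟩
    have hL : ∀ k, algebraMap L (AlgebraicClosure K)
        ((fun x : L => x ^ 2 + algebraMap K L c)^[k] 0) =
        (fun x : AlgebraicClosure K => x ^ 2 + algebraMap K (AlgebraicClosure K) c)^[k] 0 := by
      intro k
      induction k with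
      | zero => simp
      | succ k ih =>
        rw [Function.iterate_succ_apply', Function.iterate_succ_apply', ← ih]
        simp only [map_add, map_pow]
        rfl
    have hfin := arith L (algebraMap K L c) w' (by
      intro h
      apply hwK
      have : w = 0 := congrArg Subtype.val h
      exact ⟨0, by rw [this, map_zero]⟩) (by
      intro k hk
      obtain ⟨k, rfl⟩ : ∃ k', k = k' + 2 := ⟨k - 2, by omega⟩
      obtain ⟨y, hy, hy2⟩ := exists_sqrt c α hcomm b w hb.symm (n + 1) hw hwK k
      refine ⟨⟨y, hy⟩, ?_⟩
      apply (algebraMap L (AlgebraicClosure K)).injective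
      rw [map_sub, map_pow, map_pow, map_pow, hL]
      exact hy2)
    refine Set.Finite.of_finite_image (f := algebraMap K (AlgebraicClosure K)) ?_
      (algebraMap K (AlgebraicClosure K)).injective.injOn
    refine (hfin.image (algebraMap L (AlgebraicClosure K))).subset ?_
    rintro _ ⟨_, ⟨k, rfl⟩, rfl⟩
    refine ⟨_, ⟨k, rfl⟩, ?_⟩
    simp only
    rw [hL, hφ, map_zero]

end PCFAux

/-- Let `K` be a number field, `f ∈ K[x]` quadratic and `α ∈ K`. If the dynamical Galois
group `G_∞(f, α)` — the Galois group over `K` of the field generated by all iterated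
preimages of `α` under `f` — is abelian, then `f` is post-critically finite: the forward
orbit of the critical point of `f` is finite. -/
theorem pcf_of_abelian_arboreal (K : Type*) [Field K] [NumberField K]
    (f : K[X]) (hdeg : f.natDegree = 2) (α : K)
    (hab : ∀ σ τ : (IntermediateField.adjoin K
        {β : AlgebraicClosure K |
          ∃ n : ℕ, (fun x => aeval x f)^[n] β = algebraMap K (AlgebraicClosure K) α}) ≃ₐ[K]
        (IntermediateField.adjoin K
        {β : AlgebraicClosure K |
          ∃ n : ℕ, (fun x => aeval x f)^[n] β = algebraMap K (AlgebraicClosure K) α}),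
      σ * τ = τ * σ) :
    ∀ γ : K, (derivative f).eval γ = 0 →
      (Set.range fun n : ℕ => (fun x => f.eval x)^[n] γ).Finite := by
  intro γ hγ
  set S := {β : AlgebraicClosure K |
          ∃ n : ℕ, (fun x => aeval x f)^[n] β = algebraMap K (AlgebraicClosure K) α} with hS
  have hit : ∀ (σ : AlgebraicClosure K →ₐ[K] AlgebraicClosure K) (n : ℕ) (x : AlgebraicClosure K),
      σ ((fun x => aeval x f)^[n] x) = (fun x => aeval x f)^[n] (σ x) := by
    intro σ n x
    induction n with
    | zero => rfl
    | succ n ih =>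
      rw [Function.iterate_succ_apply', Function.iterate_succ_apply', ← ih]
      exact (Polynomial.aeval_algHom_apply σ _ f).symm
  have hnormal : Normal K (IntermediateField.adjoin K S) := by
    rw [IntermediateField.normal_iff_forall_map_le]
    intro σ
    rw [IntermediateField.adjoin_map]
    apply IntermediateField.adjoin.mono
    rintro _ ⟨x, ⟨n, hn⟩, rfl⟩
    refine ⟨n, ?_⟩
    have := hit σ n x
    rw [hn, AlgHom.commutes] at this
    exact this.symm
  have hcommS : ∀ (σ τ : AlgebraicClosure K ≃ₐ[K] AlgebraicClosure K) (x : AlgebraicClosure K),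
      x ∈ S → σ (τ x) = τ (σ x) := by
    intro σ τ x hx
    let E := IntermediateField.adjoin K S
    let x' : E := ⟨x, IntermediateField.subset_adjoin K S hx⟩
    have h1 := congrArg (fun ρ => ρ x') (hab (σ.restrictNormal E) (τ.restrictNormal E))
    have h2 := congrArg (algebraMap E (AlgebraicClosure K)) h1
    simp only [AlgEquiv.mul_apply, AlgEquiv.restrictNormal_commutes] at h2
    exact h2
  set a := f.coeff 2 with ha
  set b := f.coeff 1 with hb
  set d := f.coeff 0 with hd
  have ha0 : a ≠ 0 := by
    have : f.leadingCoeff ≠ 0 := by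
      rw [Ne, Polynomial.leadingCoeff_eq_zero]
      rintro rfl
      simp at hdeg
    rwa [Polynomial.leadingCoeff, hdeg] at this
  have hf : f = C a * X ^ 2 + C b * X + C d := Polynomial.eq_quadratic_of_degree_le_two
    (Polynomial.natDegree_le_iff_degree_le.1 hdeg.le)
  set c : K := a * d + b / 2 - b ^ 2 / 4 with hc
  have hconjK : ∀ (n : ℕ) (x : K), a * ((fun x => f.eval x)^[n] x) + b / 2 =
      (fun x : K => x ^ 2 + c)^[n] (a * x + b / 2) := by
    intro n x
    induction n with
    | zero => rfl
    | succ n ih =>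
      rw [Function.iterate_succ_apply', Function.iterate_succ_apply', ← ih]
      generalize (fun x => f.eval x)^[n] x = z
      simp only [hc]
      rw [hf]
      simp only [eval_add, eval_mul, eval_C, eval_pow, eval_X]
      ring
  let φ := algebraMap K (AlgebraicClosure K)
  have hφa : φ a ≠ 0 := by simpa using ha0
  have hconj : ∀ (n : ℕ) (x : AlgebraicClosure K),
      φ a * ((fun x => aeval x f)^[n] x) + φ (b / 2) =
      (fun x : AlgebraicClosure K => x ^ 2 + φ c)^[n] (φ a * x + φ (b / 2)) := by
    intro n x
    induction n with
    | zero => rfl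
    | succ n ih =>
      rw [Function.iterate_succ_apply', Function.iterate_succ_apply', ← ih]
      generalize (fun x => aeval x f)^[n] x = z
      have h4 : φ c = φ a * φ d + φ (b / 2) - φ (b / 2) ^ 2 := by
        rw [← map_pow, ← map_mul, ← map_add, ← map_sub]
        congr 1
        rw [hc]; ring
      have h2 : φ b = 2 * φ (b / 2) := by
        rw [← map_ofNat φ 2, ← map_mul]
        congr 1
        ring
      simp only [h4]
      rw [hf]
      simp only [map_add, map_mul, aeval_C, map_pow, aeval_X]
      change φ a * (φ a * z ^ 2 + φ b * z + φ d) + _ = _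
      rw [h2]
      ring
  have hcore := PCFAux.core c (a * α + b / 2) (by
    intro σ τ n β hβ
    set x := (β - φ (b / 2)) / φ a with hx
    have hβx : β = φ a * x + φ (b / 2) := by
      rw [hx, mul_div_cancel₀ _ hφa]; ring
    have hxS : x ∈ S := by
      refine ⟨n, ?_⟩
      have h1 := hconj n x
      rw [← hβx] at h1
      have h2 : φ a * ((fun x => aeval x f)^[n] x) + φ (b / 2) = φ (a * α + b / 2) := h1.trans hβ
      rw [map_add, map_mul] at h2
      exact mul_left_cancel₀ hφa (add_right_cancel h2)
    have h3 := hcommS σ τ x hxS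
    have e : ∀ (ρ : AlgebraicClosure K ≃ₐ[K] AlgebraicClosure K) (r : K), ρ (φ r) = φ r :=
      fun ρ r => ρ.commutes r
    rw [hβx]
    simp only [map_add, map_mul, e, h3])
  have hγ0 : a * γ + b / 2 = 0 := by
    rw [hf] at hγ
    simp at hγ
    linear_combination hγ / 2
  refine Set.Finite.of_finite_image (f := fun x => a * x + b / 2) (hcore.subset ?_) ?_
  · rintro _ ⟨_, ⟨n, rfl⟩, rfl⟩
    refine ⟨n, ?_⟩
    simp only
    rw [hconjK, hγ0]
  · intro x _ y _ hxy
    exact mul_left_cancel₀ ha0 (add_right_cancel hxy)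
end

section
/- For d ≥ 3 odd, the polynomials T_d(x) and −T_d(x) are not conjugate over any field of characteristic 0: there is no affine (or Möbius restricted to affine) map m(x) = ax + b with a ≠ 0 such that m⁻¹(T_d(m(x))) = −T_d(x). -/
open Polynomial

lemma aux_infinite (K : Type*) [Field K] [CharZero K] (p q : K[X])
    (h : ∀ x : Kˣ, p.eval ((x : K) + ((x⁻¹ : Kˣ) : K)) = q.eval ((x : K) + ((x⁻¹ : Kˣ) : K))) :
    p = q := by
  have hne : ∀ n : ℕ, ((n : K) + 2) ≠ 0 := fun n => by
    have : ((n + 2 : ℕ) : K) ≠ 0 := Nat.cast_ne_zero.mpr (by omega)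
    simpa using this
  apply eq_of_infinite_eval_eq
  refine (Set.infinite_of_injective_forall_mem
    (f := fun n : ℕ => ((n : K) + 2) + ((n : K) + 2)⁻¹) ?_ ?_)
  · intro m n hmn
    have hm := hne m
    have hn := hne n
    have h1 : ((m : K) - n) * (((m : K) + 2) * ((n : K) + 2) - 1) = 0 := by
      simp only at hmn
      field_simp at hmn
      linear_combination hmn
    rcases mul_eq_zero.mp h1 with h1 | h1
    · exact_mod_cast sub_eq_zero.mp h1
    · have h2 : (m + 2) * (n + 2) = 1 := by exact_mod_cast sub_eq_zero.mp h1
      nlinarith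
  · intro n
    simpa using h (Units.mk0 _ (hne n))

lemma aux_dickson_high (K : Type*) [Field K] (n : ℕ) :
    (∀ k, n < k → 0 < n → (dickson 1 (1 : K) n).coeff k = 0) ∧
    (∀ k, n + 1 < k → (dickson 1 (1 : K) (n + 1)).coeff k = 0) := by
  induction n with
  | zero =>
    refine ⟨fun k _ h => absurd h (by omega), fun k hk => ?_⟩
    simp [coeff_X]; omega
  | succ n ih =>
    refine ⟨fun k hk _ => ih.2 k hk, fun k hk => ?_⟩
    obtain ⟨k, rfl⟩ : ∃ j, k = j + 1 := ⟨k - 1, by omega⟩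
    rw [dickson_add_two, coeff_sub, coeff_X_mul, ih.2 k (by omega), C_1, one_mul]
    rcases Nat.eq_zero_or_pos n with rfl | hn
    · norm_num [dickson_zero]
    · rw [ih.1 _ (by omega) hn, sub_zero]

lemma aux_lead (K : Type*) [Field K] (n : ℕ) : (dickson 1 (1 : K) (n + 1)).coeff (n + 1) = 1 := by
  induction n with
  | zero => simp
  | succ n ih =>
    rw [dickson_add_two, coeff_sub, coeff_X_mul, ih, C_1, one_mul]
    rcases Nat.eq_zero_or_pos n with rfl | hn
    · norm_num [dickson_zero]
    · rw [(aux_dickson_high K n).1 _ (by omega) hn, sub_zero]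

lemma aux_sub (K : Type*) [Field K] (n : ℕ) :
    (dickson 1 (1 : K) (n + 2)).coeff n = -((n : K) + 2) := by
  induction n with
  | zero => simp [dickson_two]; norm_num
  | succ n ih =>
    rw [dickson_add_two, coeff_sub, coeff_X_mul, ih, C_1, one_mul, aux_lead]
    push_cast; ring

theorem chebyshev_not_conjugate_neg (K : Type*) [Field K] [CharZero K]
    (d : ℕ) (hd : 3 ≤ d) (hodd : Odd d) (T : K[X]) (hTdeg : T.natDegree = d)
    (hT : ∀ x : Kˣ, T.eval ((x : K) + ((x⁻¹ : Kˣ) : K)) =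
      (x : K) ^ d + ((x⁻¹ : Kˣ) : K) ^ d) :
    ¬ ∃ a b : K, a ≠ 0 ∧ T.comp (C a * X + C b) = C a * (-T) + C b := by
  rintro ⟨a, b, ha, hab⟩
  have hD : T = dickson 1 (1 : K) d := aux_infinite K _ _ fun x => by
    rw [hT, dickson_one_one_eval_add_inv _ _ (by simp)]
  have hneg : T.comp (-X) = -T := aux_infinite K _ _ fun x => by
    have := hT (-x)
    have h2 := hT x
    simp only [eval_comp, eval_neg, eval_X, h2]
    rw [inv_neg, Units.val_neg, Units.val_neg, hodd.neg_pow, hodd.neg_pow, ← neg_add] at this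
    rw [this]; ring
  have hodd' : ∀ y, T.eval (-y) = -T.eval y := fun y => by
    simpa using congrArg (eval y) hneg
  have hE : ∀ y, T.eval (a * y + b) = a * (-T.eval y) + b := fun y => by
    simpa using congrArg (eval y) hab
  have hshift : ∀ z, T.eval (z + 2 * b) = T.eval z + 2 * b := fun z => by
    have h1 := hE ((z + b) / a)
    have h2 := hE (-((z + b) / a))
    have e1 : a * ((z + b) / a) + b = z + 2 * b := by field_simp; ring
    have e2 : a * (-((z + b) / a)) + b = -z := by field_simp; ring
    rw [e1] at h1
    rw [e2, hodd', hodd'] at h2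
    linear_combination h1 + h2
  have hb : b = 0 := by
    by_contra hb
    have h0 : T.eval 0 = 0 := by
      have := hodd' 0
      rw [neg_zero] at this
      exact self_eq_neg.mp this
    have hn : ∀ n : ℕ, T.eval ((n : K) * (2 * b)) = n * (2 * b) := by
      intro n
      induction n with
      | zero => simpa using h0
      | succ n ih =>
        push_cast
        rw [add_mul, one_mul, hshift, ih]
    have hX : T = X := by
      apply eq_of_infinite_eval_eq
      refine Set.infinite_of_injective_forall_mem (f := fun n : ℕ => (n : K) * (2 * b)) ?_ ?_
      · intro m n hmn
        have : (2 * b) ≠ 0 := by simpa using hb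
        exact_mod_cast mul_right_cancel₀ this hmn
      · intro n
        simpa using hn n
    rw [hX, natDegree_X] at hTdeg
    omega
  subst hb
  have hc : ∀ n, T.coeff n * a ^ n = -(a * T.coeff n) := fun n => by
    have := congrArg (fun p => coeff p n) hab
    simpa [comp_C_mul_X_coeff] using this
  obtain ⟨n, rfl⟩ : ∃ n, d = n + 2 := ⟨d - 2, by omega⟩
  have h1 := hc (n + 2)
  have h2 := hc n
  rw [hD, aux_lead K (n + 1)] at h1
  rw [hD, aux_sub] at h2
  have hne : ((n : K) + 2) ≠ 0 := by
    have : ((n + 2 : ℕ) : K) ≠ 0 := Nat.cast_ne_zero.mpr (by omega)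
    simpa using this
  have h3 : a ^ n = -a := mul_left_cancel₀ hne (by linear_combination -h2)
  have h4 : a ^ 2 = 1 := by
    apply mul_left_cancel₀ ha
    rw [pow_add, h3] at h1
    linear_combination -h1
  obtain ⟨k, hk⟩ := hodd
  have h5 : a ^ (n + 2) = a := by rw [hk, pow_succ, pow_mul, h4]; simp
  rw [h5] at h1
  exact ha (self_eq_neg.mp (by linear_combination h1))
end
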